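/- arXiv:1808.05714 — 5 statements merged into one kernel-verified Lean document; each statement's English description precedes it below -/
import Mathlib

section
/- Let C : ℤ → U(2) be an arbitrary coin map, written C(x) = C_{α(x),β(x),θ(x)}, and let U be the associated quantum walk evolution operator. Then there exists a gauge transformation G — a unitary on H of the form (Gu)(x) = (e^{ig↑(x)}u↑(x), e^{ig↓(x)}u↓(x)) with real-valued g↑, g↓ : ℤ → ℝ — such that U = G⁻¹ ∘ U' ∘ G, where U' is the quantum walk evolution operator associated with the coin map C'(x) = C_{α(x), √(1−|α(x)|²), θ(x)}. -/
open Complex Matrix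

noncomputable section

/-- The coin matrix `C_{α,β,θ} = e^{iθ}[[β, conj α],[−α, conj β]]`. -/
def coinMat (a b : ℂ) (t : ℝ) : Matrix (Fin 2) (Fin 2) ℂ :=
  Complex.exp ((t : ℂ) * Complex.I) • !![b, (starRingEnd ℂ) a; -a, (starRingEnd ℂ) b]

/-- The quantum walk evolution operator `U = SĈ`, acting on arbitrary `u : ℤ → ℂ²`:
`(Uu)↑(x) = (C(x−1)u(x−1))↑`, `(Uu)↓(x) = (C(x+1)u(x+1))↓`. -/
def qw (C : ℤ → Matrix (Fin 2) (Fin 2) ℂ) (u : ℤ → Fin 2 → ℂ) : ℤ → Fin 2 → ℂ :=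
  fun x => ![(C (x - 1)).mulVec (u (x - 1)) 0, (C (x + 1)).mulVec (u (x + 1)) 1]

/-- `ρ = √(1−|a|²)`. -/
def rho (a : ℂ) : ℝ := Real.sqrt (1 - ‖a‖ ^ 2)

/-- The coin map `x ↦ C_{α(x), ρ(x), θ(x)}`. -/
def coinOf (α : ℤ → ℂ) (θ : ℤ → ℝ) : ℤ → Matrix (Fin 2) (Fin 2) ℂ :=
  fun x => coinMat (α x) ((rho (α x) : ℝ) : ℂ) (θ x)

/-- The transfer matrix `T_λ(x)`. -/
def Tmat (α : ℤ → ℂ) (θ : ℤ → ℝ) (lam : ℂ) (x : ℤ) : Matrix (Fin 2) (Fin 2) ℂ :=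
  (((rho (α x) : ℝ) : ℂ))⁻¹ •
    !![Complex.exp (Complex.I * (lam - (θ x : ℂ))), α x;
       (starRingEnd ℂ) (α x), Complex.exp (-(Complex.I * (lam - (θ x : ℂ))))]

/-- `(J_VE u)(x) = (u↓(x−1), u↑(x))`. -/
def Jve (u : ℤ → Fin 2 → ℂ) : ℤ → Fin 2 → ℂ := fun x => ![u (x - 1) 1, u x 0]

/-- `(J_EV v)(x) = (v↓(x), v↑(x+1))`, the inverse of `J_VE`. -/
def Jev (v : ℤ → Fin 2 → ℂ) : ℤ → Fin 2 → ℂ := fun x => ![v x 1, v (x + 1) 0]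

/-- Determinant of the 2×2 matrix with columns `v, w`. -/
def det2 (v w : Fin 2 → ℂ) : ℂ := v 0 * w 1 - v 1 * w 0

/-- The Euclidean norm on ℂ². -/
def nrm2 (v : Fin 2 → ℂ) : ℝ := Real.sqrt (‖v 0‖ ^ 2 + ‖v 1‖ ^ 2)

/-- Membership in `l²(ℤ, ℂ²)`. -/
def MemL2 (u : ℤ → Fin 2 → ℂ) : Prop := Summable fun x : ℤ => ‖u x 0‖ ^ 2 + ‖u x 1‖ ^ 2

/-- The Japanese bracket `⟨x⟩ = √(1+x²)`. -/
def jp (x : ℤ) : ℝ := Real.sqrt (1 + (x : ℝ) ^ 2)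

/-- A gaugeT transformation with phases `g↑ = g`, `g↓ = h`. -/
def gaugeT (g h : ℤ → ℝ) (u : ℤ → Fin 2 → ℂ) : ℤ → Fin 2 → ℂ :=
  fun x => ![Complex.exp ((g x : ℂ) * Complex.I) * u x 0,
             Complex.exp ((h x : ℂ) * Complex.I) * u x 1]

/-- Every function on `ℤ` with values in an abelian group has a discrete primitive. -/
theorem exists_int_primitive {M : Type*} [AddCommGroup M] (a : ℤ → M) :
    ∃ g : ℤ → M, ∀ x, g (x + 1) = g x + a x := by
  refine ⟨fun x => ∑ i ∈ Finset.range x.toNat, a i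
    - ∑ i ∈ Finset.range (-x).toNat, a (-((i : ℤ) + 1)), fun x => ?_⟩
  obtain ⟨n, rfl | rfl⟩ : ∃ n : ℕ, x = n ∨ x = -((n : ℤ) + 1) := by
    rcases le_or_gt 0 x with h | h
    · exact ⟨x.toNat, Or.inl (by omega)⟩
    · exact ⟨(-x - 1).toNat, Or.inr (by omega)⟩
  · have h₁ : ((n : ℤ) + 1).toNat = n + 1 := by omega
    have h₂ : (-((n : ℤ) + 1)).toNat = 0 := by omega
    have h₃ : (-(n : ℤ)).toNat = 0 := by omega
    simp only [h₁, h₂, h₃, Int.toNat_natCast, Finset.sum_range_succ, Finset.sum_range_zero]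
    abel
  · have h₁ : (-((n : ℤ) + 1) + 1).toNat = 0 := by omega
    have h₂ : (-(-((n : ℤ) + 1) + 1)).toNat = n := by omega
    have h₃ : (-((n : ℤ) + 1)).toNat = 0 := by omega
    have h₄ : (-(-((n : ℤ) + 1))).toNat = n + 1 := by omega
    simp only [h₁, h₂, h₃, h₄, Finset.sum_range_succ, Finset.sum_range_zero]
    abel

theorem rho_eq_norm {a b : ℂ} (h : ‖a‖ ^ 2 + ‖b‖ ^ 2 = 1) : rho a = ‖b‖ := by
  rw [rho, ← h, add_sub_cancel_left, Real.sqrt_sq (norm_nonneg b)]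

theorem conj_eq_norm_mul_exp_neg_arg (b : ℂ) :
    (starRingEnd ℂ) b = ‖b‖ * Complex.exp (-(b.arg * Complex.I)) := by
  conv_lhs => rw [← Complex.norm_mul_exp_arg_mul_I b]
  rw [map_mul, Complex.conj_ofReal, ← Complex.exp_conj, map_mul, Complex.conj_ofReal,
    Complex.conj_I, mul_neg]

/-- there is a gaugeT transformation `G` with `U = G⁻¹ ∘ U' ∘ G`, where `U'`
is the quantum walk with coin `C_{α(x), √(1−|α(x)|²), θ(x)}`. -/
theorem stmt0 (α β : ℤ → ℂ) (θ : ℤ → ℝ)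
    (hunit : ∀ x : ℤ, ‖α x‖ ^ 2 + ‖β x‖ ^ 2 = 1) :
    ∃ gup gdn : ℤ → ℝ, ∀ u : ℤ → Fin 2 → ℂ,
      qw (fun x => coinMat (α x) (β x) (θ x)) u
        = gaugeT (fun x => -gup x) (fun x => -gdn x)
            (qw (coinOf α θ) (gaugeT gup gdn u)) := by
  obtain ⟨g, hg⟩ := exists_int_primitive fun x => -(β x).arg
  refine ⟨g, fun x => g (x + 1), fun u => ?_⟩
  funext x j
  fin_cases j
  · have hgx : g x = g (x - 1) - (β (x - 1)).arg := by
      simpa [sub_eq_add_neg] using hg (x - 1)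
    have hb := Complex.norm_mul_exp_arg_mul_I (β (x - 1))
    simp only [qw, gaugeT, coinOf, coinMat, rho_eq_norm (hunit _), Fin.zero_eta, mulVec,
      dotProduct, Fin.sum_univ_two, Matrix.smul_apply, smul_eq_mul, of_apply, cons_val', cons_val_zero,
      cons_val_one, sub_add_cancel]
    rw [hgx]
    generalize ‖β (x - 1)‖ = r, (β (x - 1)).arg = t at hb ⊢
    rw [← hb]
    simp only [Complex.ofReal_neg, Complex.ofReal_sub, neg_mul, sub_mul, Complex.exp_neg,
      Complex.exp_sub]
    field_simp
  · have hb := conj_eq_norm_mul_exp_neg_arg (β (x + 1))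
    simp only [qw, gaugeT, coinOf, coinMat, rho_eq_norm (hunit _), Fin.mk_one, mulVec,
      dotProduct, Fin.sum_univ_two, Matrix.smul_apply, smul_eq_mul, of_apply, cons_val', cons_val_zero,
      cons_val_one, Complex.conj_ofReal]
    rw [hg (x + 1), hb]
    simp only [Complex.ofReal_neg, Complex.ofReal_add, neg_mul, add_mul, Complex.exp_neg,
      Complex.exp_add]
    field_simp
end
end

section
/- For any u : ℤ → ℂ² and any λ ∈ ℂ, u satisfies the generalized eigenvalue equation (Uu)(x) = e^{iλ}u(x) for all x ∈ ℤ if and only if (J_VE u)(x+1) = T_λ(x)·(J_VE u)(x) for all x ∈ ℤ. -/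
open Complex Matrix

noncomputable section

lemma rho_ne_zero {a : ℂ} (ha : ‖a‖ < 1) : ((rho a : ℝ) : ℂ) ≠ 0 := by
  have h : 0 < 1 - ‖a‖ ^ 2 := by nlinarith [norm_nonneg a]
  exact_mod_cast (Real.sqrt_pos.2 h).ne'

lemma rho_sq {a : ℂ} (ha : ‖a‖ < 1) :
    ((rho a : ℝ) : ℂ) ^ 2 = 1 - a * (starRingEnd ℂ) a := by
  have h : 0 ≤ 1 - ‖a‖ ^ 2 := by nlinarith [norm_nonneg a]
  rw [Complex.mul_conj']
  exact_mod_cast Real.sq_sqrt h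

/-- The scattering relations at a vertex are equivalent to the transfer relations. -/
lemma scattering_iff_transfer {e z r a b p q s t : ℂ} (he : e ≠ 0) (hz : z ≠ 0) (hr : r ≠ 0)
    (hrs : r ^ 2 = 1 - a * b) :
    (e * (r * s + b * t) = z * p ∧ e * (-a * s + r * t) = z * q) ↔
      (t = r⁻¹ * (z / e * q + a * s) ∧ p = r⁻¹ * (b * q + e / z * s)) := by
  have h₁ : t = r⁻¹ * (z / e * q + a * s) ↔ e * (-a * s + r * t) = z * q := by
    field_simp
    constructor <;> intro h <;> linear_combination h
  have h₂ : p = r⁻¹ * (b * q + e / z * s) ↔ z * r * p = z * b * q + e * s := by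
    field_simp
  rw [h₁, h₂, and_comm]
  refine and_congr_right fun h => ⟨fun h' => ?_, fun h' => mul_left_cancel₀ hr ?_⟩
  · linear_combination (-r) * h' + b * h + e * s * hrs
  · linear_combination (-1 : ℂ) * h' + b * h + e * s * hrs

lemma qw_eq_iff (α : ℤ → ℂ) (θ : ℤ → ℝ) (u : ℤ → Fin 2 → ℂ) (z : ℂ) :
    (∀ x, qw (coinOf α θ) u x = z • u x) ↔
      ∀ x, (coinOf α θ x).mulVec (u x) 0 = z * u (x + 1) 0 ∧
        (coinOf α θ x).mulVec (u x) 1 = z * u (x - 1) 1 := by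
  simp only [funext_iff, Fin.forall_fin_two, forall_and]
  refine and_congr ⟨fun h x => ?_, fun h x => ?_⟩ ⟨fun h x => ?_, fun h x => ?_⟩
  · simpa [qw] using h (x + 1)
  · simpa [qw] using h (x - 1)
  · simpa [qw] using h (x - 1)
  · simpa [qw] using h (x + 1)

/-- the generalized eigenvalue equation `Uu = e^{iλ}u` is equivalent to the
transfer-matrix recursion `(J_VE u)(x+1) = T_λ(x)(J_VE u)(x)`. -/
theorem stmt1 (α : ℤ → ℂ) (θ : ℤ → ℝ) (hα : ∀ x : ℤ, ‖α x‖ < 1)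
    (u : ℤ → Fin 2 → ℂ) (lam : ℂ) :
    (∀ x : ℤ, qw (coinOf α θ) u x = Complex.exp (Complex.I * lam) • u x) ↔
    (∀ x : ℤ, Jve u (x + 1) = (Tmat α θ lam x).mulVec (Jve u x)) := by
  rw [qw_eq_iff]
  refine forall_congr' fun x => ?_
  have key := scattering_iff_transfer (e := Complex.exp ((θ x : ℂ) * Complex.I))
    (z := Complex.exp (Complex.I * lam)) (p := u (x + 1) 0) (q := u (x - 1) 1)
    (s := u x 0) (t := u x 1) (Complex.exp_ne_zero _) (Complex.exp_ne_zero _)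
    (rho_ne_zero (hα x)) (rho_sq (hα x))
  rw [← Complex.exp_sub, ← Complex.exp_sub] at key
  have e₁ : Complex.I * (lam - (θ x : ℂ)) = Complex.I * lam - (θ x : ℂ) * Complex.I := by ring
  simp only [funext_iff, Fin.forall_fin_two, Tmat, e₁, neg_sub]
  simpa [coinOf, coinMat, Jve, Matrix.mulVec, dotProduct, Fin.sum_univ_two, mul_add,
    mul_assoc] using key
end
end

section
/- Let λ ∈ ℂ and let u₁, u₂ : ℤ → ℂ² both satisfy the generalized eigenvalue equation (Uu)(x) = e^{iλ}u(x) for all x ∈ ℤ. If u₁ is bounded on ℤ≥0 = {x ∈ ℤ : x ≥ 0} and u₂ ∈ l²(ℤ,ℂ²), then u₁ and u₂ are linearly dependent, i.e., there exist (c₁,c₂) ≠ (0,0) with c₁u₁ + c₂u₂ = 0. -/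
open Complex Matrix

noncomputable section

/-- The upper component of the eigenvalue equation, read off at the site `x + 1`. -/
lemma qw_eigen_up {α : ℤ → ℂ} {θ : ℤ → ℝ} {E : ℂ} {u : ℤ → Fin 2 → ℂ}
    (h : ∀ x : ℤ, qw (coinOf α θ) u x = E • u x) (x : ℤ) :
    E * u (x + 1) 0 = Complex.exp ((θ x : ℂ) * Complex.I) *
      ((rho (α x) : ℂ) * u x 0 + (starRingEnd ℂ) (α x) * u x 1) := by
  have := congrFun (h (x + 1)) 0
  simp [qw, coinOf, coinMat, Matrix.mulVec, dotProduct, Fin.sum_univ_two] at this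
  rw [← this]
  ring

/-- The lower component of the eigenvalue equation, read off at the site `x - 1`. -/
lemma qw_eigen_down {α : ℤ → ℂ} {θ : ℤ → ℝ} {E : ℂ} {u : ℤ → Fin 2 → ℂ}
    (h : ∀ x : ℤ, qw (coinOf α θ) u x = E • u x) (x : ℤ) :
    E * u (x - 1) 1 = Complex.exp ((θ x : ℂ) * Complex.I) *
      (-(α x) * u x 0 + (rho (α x) : ℂ) * u x 1) := by
  have := congrFun (h (x - 1)) 1
  simp [qw, coinOf, coinMat, Matrix.mulVec, dotProduct, Fin.sum_univ_two] at this
  rw [← this]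
  ring

lemma rho_pos {a : ℂ} (ha : ‖a‖ < 1) : 0 < rho a :=
  Real.sqrt_pos.2 (by nlinarith [norm_nonneg a])

lemma norm_le_nrm2 (v : Fin 2 → ℂ) (i : Fin 2) : ‖v i‖ ≤ nrm2 v := by
  apply Real.le_sqrt_of_sq_le
  fin_cases i <;> simp

/-- The Wronskian of two generalized eigenfunctions is constant. -/
lemma det2_Jve_eq {α : ℤ → ℂ} {θ : ℤ → ℝ} {E : ℂ} (hE : E ≠ 0) {u₁ u₂ : ℤ → Fin 2 → ℂ}
    (h₁ : ∀ x : ℤ, qw (coinOf α θ) u₁ x = E • u₁ x)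
    (h₂ : ∀ x : ℤ, qw (coinOf α θ) u₂ x = E • u₂ x) (x : ℤ) :
    det2 (Jve u₁ x) (Jve u₂ x) = det2 (Jve u₁ 0) (Jve u₂ 0) := by
  have step (y : ℤ) : det2 (Jve u₁ (y + 1)) (Jve u₂ (y + 1)) = det2 (Jve u₁ y) (Jve u₂ y) := by
    apply mul_left_cancel₀ hE
    simp only [det2, Jve, Matrix.cons_val_zero, Matrix.cons_val_one, add_sub_cancel_right]
    linear_combination u₁ y 1 * qw_eigen_up h₂ y - u₂ y 1 * qw_eigen_up h₁ y
      - u₂ y 0 * qw_eigen_down h₁ y + u₁ y 0 * qw_eigen_down h₂ y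
  induction x with
  | zero => rfl
  | succ n ih => rw [step, ih]
  | pred n ih => rw [← ih, ← step, sub_add_cancel]

/-- A generalized eigenfunction is determined by its value on the edge at `0`. -/
lemma eq_zero_of_Jve_zero {α : ℤ → ℂ} {θ : ℤ → ℝ} (hα : ∀ x : ℤ, ‖α x‖ < 1) {E : ℂ} (hE : E ≠ 0)
    {u : ℤ → Fin 2 → ℂ} (h : ∀ x : ℤ, qw (coinOf α θ) u x = E • u x)
    (hd : u (-1) 1 = 0) (hu : u 0 0 = 0) (x : ℤ) : u x = 0 := by
  have hρ (y : ℤ) : (rho (α y) : ℂ) ≠ 0 := by exact_mod_cast (rho_pos (hα y)).ne'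
  have key (y : ℤ) : u (y - 1) 1 = 0 ∧ u y 0 = 0 := by
    induction y with
    | zero => exact ⟨by simpa using hd, hu⟩
    | succ n ih =>
      have e₁ := qw_eigen_down h n
      have e₂ := qw_eigen_up h n
      have h₀ : u n 1 = 0 := by simpa [ih.1, ih.2, hρ, Complex.exp_ne_zero] using e₁
      refine ⟨by simpa using h₀, ?_⟩
      simpa [ih.2, h₀, hE] using e₂
    | pred n ih =>
      have e₁ := qw_eigen_down h (-n - 1)
      have e₂ := qw_eigen_up h (-n - 1)
      rw [sub_add_cancel] at e₂
      have h₀ : u (-n - 1) 0 = 0 := by simpa [ih.1, ih.2, hρ, Complex.exp_ne_zero] using e₂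
      refine ⟨?_, h₀⟩
      simpa [ih.1, h₀, hE] using e₁
  ext i
  fin_cases i
  · exact (key x).2
  · simpa using (key (x + 1)).1

/-- Two vectors with vanishing determinant are linearly dependent. -/
lemma exists_combination_of_det2_eq_zero {v w : Fin 2 → ℂ} (h : det2 v w = 0) :
    ∃ c₁ c₂ : ℂ, ¬(c₁ = 0 ∧ c₂ = 0) ∧ c₁ • v + c₂ • w = 0 := by
  unfold det2 at h
  by_cases h₀ : v 0 = 0 ∧ w 0 = 0
  · by_cases h₁ : v 1 = 0 ∧ w 1 = 0
    · refine ⟨1, 0, by simp, ?_⟩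
      ext i
      fin_cases i <;> simp [h₀, h₁]
    · refine ⟨w 1, -v 1, fun hc => h₁ ⟨neg_eq_zero.1 hc.2, hc.1⟩, ?_⟩
      ext i
      fin_cases i
      · simp [h₀]
      · simp
        ring
  · refine ⟨w 0, -v 0, fun hc => h₀ ⟨neg_eq_zero.1 hc.2, hc.1⟩, ?_⟩
    ext i
    fin_cases i
    · simp
      ring
    · simp
      linear_combination -h

/-- The Wronskian of a bounded and a square-summable function tends to zero at `+∞`. -/
lemma tendsto_det2_Jve {u₁ u₂ : ℤ → Fin 2 → ℂ}
    (hb : ∃ M : ℝ, ∀ x : ℤ, 0 ≤ x → nrm2 (u₁ x) ≤ M) (hl2 : MemL2 u₂) :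
    Filter.Tendsto (fun n : ℕ => det2 (Jve u₁ (n + 1)) (Jve u₂ (n + 1))) Filter.atTop (nhds 0) := by
  obtain ⟨M, hM⟩ := hb
  have ht : Filter.Tendsto (fun n : ℕ => nrm2 (u₂ n)) Filter.atTop (nhds 0) := by
    have h := (hl2.comp_injective Nat.cast_injective).tendsto_atTop_zero.sqrt
    simpa [nrm2, Function.comp_def] using h
  have ht' := (ht.comp (Filter.tendsto_add_atTop_nat 1)).const_mul M
  have hsum := (ht.const_mul M).add ht'
  rw [mul_zero, add_zero] at hsum
  refine squeeze_zero_norm (fun n => ?_) hsum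
  have b₁ (x : ℤ) (hx : 0 ≤ x) (i : Fin 2) : ‖u₁ x i‖ ≤ M := (norm_le_nrm2 _ i).trans (hM x hx)
  have hM₀ : 0 ≤ M := (norm_nonneg _).trans (b₁ 0 le_rfl 0)
  simp only [det2, Jve, Matrix.cons_val_zero, Matrix.cons_val_one, add_sub_cancel_right,
    Function.comp_apply, Nat.cast_add, Nat.cast_one]
  refine (norm_sub_le _ _).trans ?_
  rw [norm_mul, norm_mul, add_comm]
  gcongr
  · exact b₁ _ (by positivity) _
  · exact norm_le_nrm2 _ _
  · exact b₁ _ (by positivity) _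
  · exact norm_le_nrm2 _ _

/-- a solution of the generalized eigenvalue equation bounded on `ℤ≥0` and one
in `l²` are linearly dependent. -/
theorem stmt3 (α : ℤ → ℂ) (θ : ℤ → ℝ) (hα : ∀ x : ℤ, ‖α x‖ < 1) (lam : ℂ)
    (u₁ u₂ : ℤ → Fin 2 → ℂ)
    (h₁ : ∀ x : ℤ, qw (coinOf α θ) u₁ x = Complex.exp (Complex.I * lam) • u₁ x)
    (h₂ : ∀ x : ℤ, qw (coinOf α θ) u₂ x = Complex.exp (Complex.I * lam) • u₂ x)
    (hb : ∃ M : ℝ, ∀ x : ℤ, 0 ≤ x → nrm2 (u₁ x) ≤ M)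
    (hl2 : MemL2 u₂) :
    ∃ c₁ c₂ : ℂ, ¬(c₁ = 0 ∧ c₂ = 0) ∧ ∀ x : ℤ, c₁ • u₁ x + c₂ • u₂ x = 0 := by
  have hE := Complex.exp_ne_zero (Complex.I * lam)
  have hW : det2 (Jve u₁ 0) (Jve u₂ 0) = 0 := by
    refine tendsto_nhds_unique (tendsto_const_nhds.congr fun n : ℕ => ?_) (tendsto_det2_Jve hb hl2)
    exact (det2_Jve_eq hE h₁ h₂ _).symm
  obtain ⟨c₁, c₂, hc, h⟩ := exists_combination_of_det2_eq_zero hW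
  refine ⟨c₁, c₂, hc, eq_zero_of_Jve_zero (θ := θ) (u := fun x => c₁ • u₁ x + c₂ • u₂ x) hα hE ?_ ?_ ?_⟩
  · intro x
    have hlin : qw (coinOf α θ) (fun x => c₁ • u₁ x + c₂ • u₂ x) x =
        c₁ • qw (coinOf α θ) u₁ x + c₂ • qw (coinOf α θ) u₂ x := by
      ext i
      fin_cases i <;> simp [qw, Matrix.mulVec_add, Matrix.mulVec_smul]
    rw [hlin, h₁, h₂, smul_add, smul_comm c₁, smul_comm c₂]
  · simpa [Jve] using congrFun h 0
  · simpa [Jve] using congrFun h 1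
end
end

section
/- The cosine function maps the half-open half-strip {z ∈ ℂ : Im z > 0, −π < Re z ≤ π} bijectively onto ℂ \ [−1,1]: for every w ∈ ℂ with w ∉ [−1,1] there exists a unique z ∈ ℂ with Im z > 0, −π < Re z ≤ π, and cos z = w. -/
open Complex

/-- Every complex number outside `[-1, 1]` is the cosine of a point of the upper half-plane. -/
theorem exists_im_pos_cos_eq (w : ℂ) (hw : w ∉ (Complex.ofReal '' Set.Icc (-1 : ℝ) 1)) :
    ∃ z : ℂ, 0 < z.im ∧ Complex.cos z = w := by
  obtain ⟨z, hz⟩ := Complex.cos_surjective w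
  rcases lt_trichotomy z.im 0 with h | h | h
  · exact ⟨-z, by simpa using h, by rw [Complex.cos_neg, hz]⟩
  · refine absurd ⟨Real.cos z.re, Real.cos_mem_Icc z.re, ?_⟩ hw
    have hre : (z.re : ℂ) = z := Complex.ext (by simp) (by simp [h])
    rw [Complex.ofReal_cos, hre, hz]
  · exact ⟨z, h, hz⟩

/-- `cos` maps `{Im z > 0, −π < Re z ≤ π}` bijectively onto `ℂ \ [−1,1]`. -/
theorem stmt9 (w : ℂ) (hw : w ∉ (Complex.ofReal '' Set.Icc (-1 : ℝ) 1)) :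
    ∃! z : ℂ, 0 < z.im ∧ -Real.pi < z.re ∧ z.re ≤ Real.pi ∧ Complex.cos z = w := by
  obtain ⟨z, hz, hzw⟩ := exists_im_pos_cos_eq w hw
  refine existsUnique_of_exists_of_unique ?_ ?_
  · have hmem := sub_toIocDiv_zsmul_mem_Ioc Real.two_pi_pos (-Real.pi) z.re
    set n := toIocDiv Real.two_pi_pos (-Real.pi) z.re
    rw [zsmul_eq_mul] at hmem
    have him : (z - n * (2 * Real.pi)).im = z.im := by simp
    have hre : (z - n * (2 * Real.pi)).re = z.re - n * (2 * Real.pi) := by simp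
    refine ⟨z - n * (2 * Real.pi), ?_, ?_, ?_, ?_⟩
    · rwa [him]
    · rw [hre]
      exact hmem.1
    · rw [hre]
      linarith [hmem.2]
    · rw [Complex.cos_sub_int_mul_two_pi, hzw]
  · rintro x y ⟨hx, hx1, hx2, hxw⟩ ⟨hy, hy1, hy2, hyw⟩
    obtain ⟨k, hk | hk⟩ := Complex.cos_eq_cos_iff.1 (hxw.trans hyw.symm)
    · have hre : y.re = 2 * k * Real.pi + x.re := by simpa using congrArg Complex.re hk
      have hlt : (k : ℝ) < 1 := by nlinarith [Real.pi_pos]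
      have hgt : (-1 : ℝ) < k := by nlinarith [Real.pi_pos]
      have hk0 : k = 0 := by
        have h1 : k < 1 := by exact_mod_cast hlt
        have h2 : -1 < k := by exact_mod_cast hgt
        omega
      simp [hk, hk0]
    · have him : y.im = -x.im := by simpa using congrArg Complex.im hk
      linarith
end

section
/- For ξ ∈ ℝ set A_{ξ,±} := e^{∓iξ}·T_{0,λ(ξ)}. There exists a constant c > 0 depending only on α₀ such that: (i) for all ξ ∈ ℝ and all x ∈ ℤ with ∓x ≥ 0, ‖(A_{ξ,±})^x‖ ≤ c·(1+|x|); and (ii) for all ξ ∈ ℝ with sin ξ ≠ 0 and all x ∈ ℤ with ∓x ≥ 0, ‖(A_{ξ,±})^x‖ ≤ c·min(1+|x|, |sin ξ|⁻¹). (Here (A_{ξ,±})^x for negative x means powers of the inverse matrix, which exists since det A_{ξ,±} has modulus 1, and ‖·‖ is the operator norm on ℂ².) -/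
open Complex Matrix

noncomputable section

/-- The free transfer matrix `T_{0,λ}` (for real `λ`). -/
def T0m (a0 : ℂ) (lam : ℝ) : Matrix (Fin 2) (Fin 2) ℂ :=
  (((rho a0 : ℝ) : ℂ))⁻¹ •
    !![Complex.exp (Complex.I * (lam : ℂ)), a0;
       (starRingEnd ℂ) a0, Complex.exp (-(Complex.I * (lam : ℂ)))]

/-- `λ(ξ) = arccos(ρ₀ cos ξ) ∈ [0,π]`. -/
def lamOf (a0 : ℂ) (ξ : ℝ) : ℝ := Real.arccos (rho a0 * Real.cos ξ)

/-- `A_{ξ,±} = e^{∓iξ}T_{0,λ(ξ)}`; `ε = 1` is the `+` case, `ε = −1` the `−` case. -/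
def Amat (a0 : ℂ) (ε : ℝ) (ξ : ℝ) : Matrix (Fin 2) (Fin 2) ℂ :=
  Complex.exp (-(((ε * ξ : ℝ) : ℂ) * Complex.I)) • T0m a0 (lamOf a0 ξ)

/-- Integer powers of a matrix: for negative exponents, powers of the inverse matrix. -/
def mzpow (A : Matrix (Fin 2) (Fin 2) ℂ) (x : ℤ) : Matrix (Fin 2) (Fin 2) ℂ :=
  if 0 ≤ x then A ^ x.toNat else A⁻¹ ^ (-x).toNat

/-- The operator norm on `ℂ²` of a 2×2 matrix. -/
def opN (A : Matrix (Fin 2) (Fin 2) ℂ) : ℝ := ‖Matrix.toEuclideanCLM (𝕜 := ℂ) A‖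

/-- A closed form for the powers of a root of `(X - a)(X - b)`. -/
theorem pow_eq_smul_one_add_sum_smul {E : Type*} [Ring E] [Algebra ℂ E] {B : E} {a b : ℂ}
    (h : (B - a • 1) * (B - b • 1) = 0) (n : ℕ) :
    B ^ n = (a ^ n) • 1 + (∑ k ∈ Finset.range n, a ^ k * b ^ (n - 1 - k)) • (B - a • 1) := by
  have hB : (B - a • 1) * B = b • (B - a • 1) := by
    rw [mul_sub, sub_eq_zero] at h
    simpa using h
  induction n with
  | zero => simp
  | succ n ih =>
    have hsum : ∑ k ∈ Finset.range (n + 1), a ^ k * b ^ (n + 1 - 1 - k)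
        = a ^ n + b * ∑ k ∈ Finset.range n, a ^ k * b ^ (n - 1 - k) :=
      (Commute.all a b).geom_sum₂_succ_eq
    rw [pow_succ, ih, add_mul, smul_mul_assoc, smul_mul_assoc, hB, one_mul, hsum, pow_succ]
    module

theorem norm_geom_sum₂_le {a b : ℂ} (ha : ‖a‖ = 1) (hb : ‖b‖ = 1) (n : ℕ) :
    ‖∑ k ∈ Finset.range n, a ^ k * b ^ (n - 1 - k)‖ ≤ n := by
  refine (norm_sum_le _ _).trans ?_
  simp [ha, hb]

theorem norm_geom_sum₂_mul_le {a b : ℂ} (ha : ‖a‖ = 1) (hb : ‖b‖ = 1) (n : ℕ) :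
    ‖∑ k ∈ Finset.range n, a ^ k * b ^ (n - 1 - k)‖ * ‖a - b‖ ≤ 2 := by
  rw [← norm_mul, (Commute.all a b).geom_sum₂_mul]
  refine (norm_sub_le _ _).trans ?_
  simp only [norm_pow, ha, hb]
  norm_num

section PowerBounds

variable {E : Type*} [NormedRing E] [NormOneClass E] [NormedAlgebra ℂ E] {B : E} {a b : ℂ} {M : ℝ}

theorem norm_pow_le_one_add_geom_sum₂_mul (h : (B - a • 1) * (B - b • 1) = 0) (ha : ‖a‖ = 1)
    (hM : ‖B‖ ≤ M) (n : ℕ) :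
    ‖B ^ n‖ ≤ 1 + ‖∑ k ∈ Finset.range n, a ^ k * b ^ (n - 1 - k)‖ * (M + 1) := by
  have hBa : ‖B - a • 1‖ ≤ M + 1 := by
    refine (norm_sub_le _ _).trans ?_
    rw [norm_smul, ha, norm_one]
    linarith
  rw [pow_eq_smul_one_add_sum_smul h n]
  refine (norm_add_le _ _).trans ?_
  rw [norm_smul, norm_smul, norm_pow, ha, norm_one, one_pow, one_mul]
  gcongr

theorem norm_pow_le_linear (h : (B - a • 1) * (B - b • 1) = 0) (ha : ‖a‖ = 1) (hb : ‖b‖ = 1)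
    (hM : ‖B‖ ≤ M) (n : ℕ) : ‖B ^ n‖ ≤ (M + 2) * (1 + n) := by
  have hM0 : 0 ≤ M := (norm_nonneg _).trans hM
  have h1 := norm_pow_le_one_add_geom_sum₂_mul h ha hM n
  have h2 := norm_geom_sum₂_le ha hb n
  nlinarith

theorem norm_pow_le_min (h : (B - a • 1) * (B - b • 1) = 0) (ha : ‖a‖ = 1) (hb : ‖b‖ = 1)
    (hM : ‖B‖ ≤ M) {s : ℝ} (hs : 0 < s) (hab : ‖a - b‖ = 2 * s) (n : ℕ) :
    ‖B ^ n‖ ≤ (M + 2) * min (1 + (n : ℝ)) s⁻¹ := by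
  have hM0 : 0 ≤ M := (norm_nonneg _).trans hM
  rw [mul_min_of_nonneg _ _ (by linarith)]
  refine le_min (norm_pow_le_linear h ha hb hM n) ?_
  have h1 := norm_pow_le_one_add_geom_sum₂_mul h ha hM n
  have h2 := norm_geom_sum₂_mul_le ha hb n
  have h3 : ‖a - b‖ ≤ 2 := (norm_sub_le _ _).trans (by rw [ha, hb]; norm_num)
  rw [hab] at h2 h3
  have h4 : 1 ≤ s⁻¹ := (one_le_inv₀ hs).2 (by linarith)
  have h5 : ‖∑ k ∈ Finset.range n, a ^ k * b ^ (n - 1 - k)‖ ≤ s⁻¹ := by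
    rw [← one_div, le_div_iff₀ hs]
    linarith
  nlinarith

end PowerBounds

theorem Matrix.sub_smul_mul_sub_smul_eq_zero {A : Matrix (Fin 2) (Fin 2) ℂ} {a b : ℂ}
    (htr : A.trace = a + b) (hdet : A.det = a * b) : (A - a • 1) * (A - b • 1) = 0 := by
  rw [Matrix.trace_fin_two] at htr
  rw [Matrix.det_fin_two] at hdet
  ext i j
  fin_cases i <;> fin_cases j <;> simp [Matrix.mul_apply, Fin.sum_univ_two]
  · linear_combination A 0 0 * htr - hdet
  · linear_combination A 0 1 * htr
  · linear_combination A 1 0 * htr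
  · linear_combination A 1 1 * htr - hdet

theorem opN_one : opN 1 = 1 := by
  rw [opN, map_one, norm_one]

theorem opN_sub_le (A B : Matrix (Fin 2) (Fin 2) ℂ) : opN (A - B) ≤ opN A + opN B := by
  simpa only [opN, map_sub] using norm_sub_le _ _

theorem opN_smul (z : ℂ) (A : Matrix (Fin 2) (Fin 2) ℂ) : opN (z • A) = ‖z‖ * opN A := by
  rw [opN, map_smul, norm_smul, opN]

theorem toEuclideanCLM_sub_smul_mul {A : Matrix (Fin 2) (Fin 2) ℂ} {a b : ℂ}
    (h : (A - a • 1) * (A - b • 1) = 0) :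
    (Matrix.toEuclideanCLM (𝕜 := ℂ) A - a • 1) * (Matrix.toEuclideanCLM (𝕜 := ℂ) A - b • 1)
      = 0 := by
  simpa only [map_mul, map_sub, map_smul, map_one, map_zero] using
    congrArg (Matrix.toEuclideanCLM (𝕜 := ℂ)) h

section InverseMatrix

variable {A : Matrix (Fin 2) (Fin 2) ℂ} {a b : ℂ}

theorem inv_eq_of_sub_smul_mul (h : (A - a • 1) * (A - b • 1) = 0) (ha : a ≠ 0) (hb : b ≠ 0) :
    A⁻¹ = (a * b)⁻¹ • ((a + b) • 1 - A) := by
  refine Matrix.inv_eq_right_inv ?_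
  have h' : A * ((a + b) • 1 - A) = (a * b) • 1 := by
    simp only [mul_sub, sub_mul, smul_mul_assoc, mul_smul_comm, one_mul, mul_one] at h ⊢
    rw [← sub_eq_zero, ← neg_eq_zero, ← h]
    module
  rw [mul_smul_comm, h', smul_smul, inv_mul_cancel₀ (mul_ne_zero ha hb), one_smul]

theorem inv_sub_smul_mul (h : (A - a • 1) * (A - b • 1) = 0) (ha : a ≠ 0) (hb : b ≠ 0) :
    (A⁻¹ - a⁻¹ • 1) * (A⁻¹ - b⁻¹ • 1) = 0 := by
  have h1 : A⁻¹ - a⁻¹ • 1 = -(a * b)⁻¹ • (A - a • 1) := by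
    rw [inv_eq_of_sub_smul_mul h ha hb]
    match_scalars <;> field_simp
    ring
  have h2 : A⁻¹ - b⁻¹ • 1 = -(a * b)⁻¹ • (A - b • 1) := by
    rw [inv_eq_of_sub_smul_mul h ha hb]
    match_scalars <;> field_simp
    ring
  rw [h1, h2, smul_mul_assoc, mul_smul_comm, h, smul_zero, smul_zero]

theorem opN_inv_le (h : (A - a • 1) * (A - b • 1) = 0) (ha : ‖a‖ = 1) (hb : ‖b‖ = 1) :
    opN A⁻¹ ≤ opN A + 2 := by
  have ha0 : a ≠ 0 := norm_ne_zero_iff.1 (by rw [ha]; exact one_ne_zero)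
  have hb0 : b ≠ 0 := norm_ne_zero_iff.1 (by rw [hb]; exact one_ne_zero)
  rw [inv_eq_of_sub_smul_mul h ha0 hb0, opN_smul, norm_inv, norm_mul, ha, hb, mul_one, inv_one,
    one_mul]
  refine (opN_sub_le _ _).trans ?_
  rw [opN_smul, opN_one, mul_one]
  have := norm_add_le a b
  rw [ha, hb] at this
  linarith

end InverseMatrix

theorem mzpow_of_nonneg (A : Matrix (Fin 2) (Fin 2) ℂ) {x : ℤ} (hx : 0 ≤ x) :
    mzpow A x = A ^ x.natAbs := by
  rw [mzpow, if_pos hx]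
  congr 1
  omega

theorem mzpow_of_nonpos (A : Matrix (Fin 2) (Fin 2) ℂ) {x : ℤ} (hx : x ≤ 0) :
    mzpow A x = A⁻¹ ^ x.natAbs := by
  rcases hx.eq_or_lt with rfl | hx
  · simp [mzpow]
  · rw [mzpow, if_neg (by omega)]
    congr 1
    omega

theorem opN_mzpow_bounds {A : Matrix (Fin 2) (Fin 2) ℂ} {a b : ℂ} {M s : ℝ}
    (h : (A - a • 1) * (A - b • 1) = 0) (ha : ‖a‖ = 1) (hb : ‖b‖ = 1) (hM : opN A ≤ M)
    (hab : ‖a - b‖ = 2 * s) (x : ℤ) :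
    opN (mzpow A x) ≤ (M + 4) * (1 + |(x : ℝ)|) ∧
      (0 < s → opN (mzpow A x) ≤ (M + 4) * min (1 + |(x : ℝ)|) s⁻¹) := by
  have ha0 : a ≠ 0 := norm_ne_zero_iff.1 (by rw [ha]; exact one_ne_zero)
  have hb0 : b ≠ 0 := norm_ne_zero_iff.1 (by rw [hb]; exact one_ne_zero)
  have hM4 : M + 4 = (M + 2) + 2 := by ring
  have hx_abs : |(x : ℝ)| = (x.natAbs : ℝ) := by rw [Nat.cast_natAbs, Int.cast_abs]
  rw [hx_abs, hM4]
  rcases le_total 0 x with hx | hx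
  · have hA : ‖Matrix.toEuclideanCLM (𝕜 := ℂ) A‖ ≤ M + 2 := by
      change opN A ≤ _
      linarith
    rw [mzpow_of_nonneg A hx, opN, map_pow]
    exact ⟨norm_pow_le_linear (toEuclideanCLM_sub_smul_mul h) ha hb hA _,
      fun hs => norm_pow_le_min (toEuclideanCLM_sub_smul_mul h) ha hb hA hs hab _⟩
  · have hA : ‖Matrix.toEuclideanCLM (𝕜 := ℂ) A⁻¹‖ ≤ M + 2 :=
      (opN_inv_le h ha hb).trans (by linarith)
    have h' := toEuclideanCLM_sub_smul_mul (inv_sub_smul_mul h ha0 hb0)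
    have ha' : ‖a⁻¹‖ = 1 := by rw [norm_inv, ha, inv_one]
    have hb' : ‖b⁻¹‖ = 1 := by rw [norm_inv, hb, inv_one]
    have hab' : ‖a⁻¹ - b⁻¹‖ = 2 * s := by
      rw [inv_sub_inv ha0 hb0, norm_div, norm_mul, ha, hb, norm_sub_rev, hab]
      ring
    rw [mzpow_of_nonpos A hx, opN, map_pow]
    exact ⟨norm_pow_le_linear h' ha' hb' hA _, fun hs => norm_pow_le_min h' ha' hb' hA hs hab' _⟩

theorem exists_opN_T0m_le (a0 : ℂ) : ∃ M : ℝ, 0 ≤ M ∧ ∀ ξ : ℝ, opN (T0m a0 (lamOf a0 ξ)) ≤ M := by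
  have hc : Continuous fun l : ℝ => T0m a0 l := by
    refine continuous_matrix fun i j => ?_
    fin_cases i <;> fin_cases j <;> simp [T0m] <;> fun_prop
  let L : Matrix (Fin 2) (Fin 2) ℂ →ₗ[ℂ]
      (EuclideanSpace ℂ (Fin 2) →L[ℂ] EuclideanSpace ℂ (Fin 2)) :=
    (Matrix.toEuclideanCLM (n := Fin 2) (𝕜 := ℂ)).toAlgEquiv.toLinearMap
  have hc' : Continuous fun l : ℝ => L (T0m a0 l) :=
    L.continuous_of_finiteDimensional.comp hc
  obtain ⟨M, hM⟩ := isCompact_Icc.exists_bound_of_continuousOn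
    (hc'.continuousOn (s := Set.Icc 0 Real.pi))
  have hM' : ∀ ξ : ℝ, opN (T0m a0 (lamOf a0 ξ)) ≤ M := fun ξ =>
    hM _ ⟨Real.arccos_nonneg _, Real.arccos_le_pi _⟩
  exact ⟨M, (norm_nonneg _).trans (hM' 0), hM'⟩

section FreeTransferMatrix

variable {a0 : ℂ}

theorem rho_pos_s11 (h : ‖a0‖ < 1) : 0 < rho a0 :=
  Real.sqrt_pos.2 (by nlinarith [norm_nonneg a0])

theorem rho_sq_s11 (h : ‖a0‖ < 1) : rho a0 ^ 2 = 1 - ‖a0‖ ^ 2 :=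
  Real.sq_sqrt (by nlinarith [norm_nonneg a0])

theorem cos_lamOf (h : ‖a0‖ < 1) (ξ : ℝ) : Real.cos (lamOf a0 ξ) = rho a0 * Real.cos ξ := by
  have h0 := rho_pos_s11 h
  have h1 : rho a0 ≤ 1 := by nlinarith [rho_sq_s11 h, sq_nonneg ‖a0‖]
  have h2 := abs_le.1 (show |rho a0 * Real.cos ξ| ≤ 1 by
    rw [abs_mul, abs_of_pos h0]
    exact mul_le_one₀ h1 (abs_nonneg _) (Real.abs_cos_le_one ξ))
  exact Real.cos_arccos h2.1 h2.2

theorem trace_T0m_lamOf (h : ‖a0‖ < 1) (ξ : ℝ) :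
    (T0m a0 (lamOf a0 ξ)).trace = exp (ξ * I) + exp (-ξ * I) := by
  have h0 : (rho a0 : ℂ) ≠ 0 := ofReal_ne_zero.2 (rho_pos_s11 h).ne'
  have hl : exp (I * (lamOf a0 ξ : ℂ)) + exp (-(I * (lamOf a0 ξ : ℂ)))
      = 2 * (rho a0 * Complex.cos ξ) := by
    rw [← ofReal_cos, ← ofReal_mul, ← cos_lamOf h ξ, ofReal_cos, two_cos]
    ring_nf
  rw [← two_cos, T0m, trace_smul, trace_fin_two_of, hl, smul_eq_mul]
  field_simp

theorem det_T0m (h : ‖a0‖ < 1) (l : ℝ) : (T0m a0 l).det = 1 := by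
  have h0 : (rho a0 : ℂ) ≠ 0 := ofReal_ne_zero.2 (rho_pos_s11 h).ne'
  have h2 : (rho a0 : ℂ) ^ 2 = 1 - (‖a0‖ : ℂ) ^ 2 := by exact_mod_cast rho_sq_s11 h
  rw [T0m, det_smul, det_fin_two_of, ← Complex.exp_add, add_neg_cancel, Complex.exp_zero,
    Complex.mul_conj', ← h2, Fintype.card_fin, inv_pow, inv_mul_cancel₀ (pow_ne_zero 2 h0)]

theorem opN_mzpow_Amat_bounds (h : ‖a0‖ < 1) {M : ℝ}
    (hM : ∀ ξ : ℝ, opN (T0m a0 (lamOf a0 ξ)) ≤ M) (ε ξ : ℝ) (x : ℤ) :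
    opN (mzpow (Amat a0 ε ξ) x) ≤ (M + 4) * (1 + |(x : ℝ)|) ∧
      (Real.sin ξ ≠ 0 →
        opN (mzpow (Amat a0 ε ξ) x) ≤ (M + 4) * min (1 + |(x : ℝ)|) |Real.sin ξ|⁻¹) := by
  set z : ℂ := exp (-(((ε * ξ : ℝ) : ℂ) * I)) with hz_def
  have hz : ‖z‖ = 1 := by
    rw [hz_def, ← neg_mul, ← ofReal_neg, norm_exp_ofReal_mul_I]
  have hp : ‖exp (ξ * I)‖ = 1 := norm_exp_ofReal_mul_I ξ
  have hm : ‖exp (-ξ * I)‖ = 1 := by rw [← ofReal_neg, norm_exp_ofReal_mul_I]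
  have hA : Amat a0 ε ξ = z • T0m a0 (lamOf a0 ξ) := rfl
  have key : (Amat a0 ε ξ - (z * exp (ξ * I)) • 1) * (Amat a0 ε ξ - (z * exp (-ξ * I)) • 1)
      = 0 := by
    refine Matrix.sub_smul_mul_sub_smul_eq_zero ?_ ?_
    · rw [hA, trace_smul, trace_T0m_lamOf h, smul_eq_mul, mul_add]
    · rw [hA, det_smul, det_T0m h, mul_mul_mul_comm, ← Complex.exp_add (ξ * I), neg_mul,
        add_neg_cancel, Complex.exp_zero, Fintype.card_fin, sq]
  have hab : ‖z * exp (ξ * I) - z * exp (-ξ * I)‖ = 2 * |Real.sin ξ| := by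
    have hs : exp (ξ * I) - exp (-ξ * I) = 2 * Real.sin ξ * I := by
      rw [ofReal_sin, Complex.two_sin, mul_assoc, I_mul_I]
      ring
    rw [← mul_sub, norm_mul, hz, hs, norm_mul, norm_mul, norm_I, norm_real, Real.norm_eq_abs]
    norm_num
  have hbound := opN_mzpow_bounds (M := M) key (by rw [norm_mul, hz, hp, one_mul])
    (by rw [norm_mul, hz, hm, one_mul]) (by rw [hA, opN_smul, hz, one_mul]; exact hM ξ) hab x
  exact ⟨hbound.1, fun hs => hbound.2 (abs_pos.2 hs)⟩

end FreeTransferMatrix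

/-- uniform bounds for powers of `A_{ξ,±} = e^{∓iξ}T_{0,λ(ξ)}`:
`‖A_{ξ,±}^x‖ ≤ c(1+|x|)` for `∓x ≥ 0`, and `‖A_{ξ,±}^x‖ ≤ c·min(1+|x|, |sin ξ|⁻¹)` when
`sin ξ ≠ 0`. -/
theorem stmt11 (α₀ : ℂ) (h₀ : 0 < ‖α₀‖) (h₁ : ‖α₀‖ < 1) :
    ∃ c : ℝ, 0 < c ∧
      (∀ ξ : ℝ, ∀ x : ℤ, x ≤ 0 →
        opN (mzpow (Amat α₀ 1 ξ) x) ≤ c * (1 + |(x : ℝ)|)) ∧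
      (∀ ξ : ℝ, ∀ x : ℤ, 0 ≤ x →
        opN (mzpow (Amat α₀ (-1) ξ) x) ≤ c * (1 + |(x : ℝ)|)) ∧
      (∀ ξ : ℝ, Real.sin ξ ≠ 0 → ∀ x : ℤ, x ≤ 0 →
        opN (mzpow (Amat α₀ 1 ξ) x) ≤ c * min (1 + |(x : ℝ)|) |Real.sin ξ|⁻¹) ∧
      (∀ ξ : ℝ, Real.sin ξ ≠ 0 → ∀ x : ℤ, 0 ≤ x →
        opN (mzpow (Amat α₀ (-1) ξ) x) ≤ c * min (1 + |(x : ℝ)|) |Real.sin ξ|⁻¹) := by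
  obtain ⟨M, hM0, hM⟩ := exists_opN_T0m_le α₀
  have h := opN_mzpow_Amat_bounds h₁ hM
  exact ⟨M + 4, by linarith, fun ξ x _ => (h 1 ξ x).1, fun ξ x _ => (h (-1) ξ x).1,
    fun ξ hs x _ => (h 1 ξ x).2 hs, fun ξ hs x _ => (h (-1) ξ x).2 hs⟩
end
end
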